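/- arXiv:2305.19114 — 5 statements merged into one kernel-verified Lean document; each statement's English description precedes it below -/
import Mathlib

section
/- Let 0 → (A_n) → (B_n) → (C_n) → 0 be a short exact sequence of inverse systems of abelian groups indexed by ℕ, i.e., for every n the sequence 0 → A_n → B_n → C_n → 0 of abelian groups is exact and all maps commute with the connecting homomorphisms. If (A_n) and (C_n) both have the Mittag-Leffler property, then so does (B_n). -/
/-- Transition map of an inverse system `(S n, f n)` indexed by `ℕ`:
for `m ≤ n`, the composite `S n → S m` of the connecting maps. -/
def InverseSystem.trans {S : ℕ → Type*} (f : ∀ n, S (n + 1) → S n) :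
    ∀ {m n : ℕ}, m ≤ n → S n → S m :=
  fun {m n} h => Nat.leRecOn (C := fun k => S k → S m) h (fun g x => g (f _ x)) id

/-- The Mittag-Leffler property for an inverse system of sets indexed by `ℕ`. -/
def InverseSystem.IsMittagLeffler {S : ℕ → Type*} (f : ∀ n, S (n + 1) → S n) : Prop :=
  ∀ m : ℕ, ∃ N : ℕ, ∃ hmN : m ≤ N, ∀ n : ℕ, ∀ hNn : N ≤ n,
    Set.range (InverseSystem.trans f (hmN.trans hNn)) = Set.range (InverseSystem.trans f hmN)

namespace InverseSystem

variable {S T : ℕ → Type*}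

theorem trans_self (f : ∀ n, S (n + 1) → S n) {m : ℕ} (x : S m) :
    trans f le_rfl x = x := by
  rw [trans, Nat.leRecOn_self, id]

theorem trans_succ (f : ∀ n, S (n + 1) → S n) {m n : ℕ} (h : m ≤ n) (x : S (n + 1)) :
    trans f (h.trans n.le_succ) x = trans f h (f n x) := by
  rw [trans, Nat.leRecOn_succ h, trans]

theorem trans_trans (f : ∀ n, S (n + 1) → S n) {k m n : ℕ} (hkm : k ≤ m) (hmn : m ≤ n)
    (x : S n) : trans f (hkm.trans hmn) x = trans f hkm (trans f hmn x) := by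
  induction n, hmn using Nat.le_induction with
  | base => rw [trans_self]
  | succ n hmn ih => rw [trans_succ f (hkm.trans hmn), trans_succ f hmn, ih]

theorem map_trans (f : ∀ n, S (n + 1) → S n) (g : ∀ n, T (n + 1) → T n) (φ : ∀ n, S n → T n)
    (hφ : ∀ n x, φ n (f n x) = g n (φ (n + 1) x)) {m n : ℕ} (h : m ≤ n) (x : S n) :
    φ m (trans f h x) = trans g h (φ n x) := by
  induction n, h using Nat.le_induction with
  | base => rw [trans_self, trans_self]
  | succ n h ih => rw [trans_succ f h, trans_succ g h, ih, hφ]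

theorem trans_add [∀ n, AddCommGroup (S n)] (f : ∀ n, S (n + 1) →+ S n) {m n : ℕ} (h : m ≤ n)
    (x y : S n) :
    trans (fun n => f n) h (x + y) = trans (fun n => f n) h x + trans (fun n => f n) h y := by
  induction n, h using Nat.le_induction with
  | base => simp only [trans_self]
  | succ n h ih => simp only [trans_succ _ h, map_add, ih]

theorem range_trans_subset (f : ∀ n, S (n + 1) → S n) {k m n : ℕ} (hkm : k ≤ m) (hmn : m ≤ n) :
    Set.range (trans f (hkm.trans hmn)) ⊆ Set.range (trans f hkm) := by
  rintro _ ⟨x, rfl⟩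
  exact ⟨trans f hmn x, (trans_trans f hkm hmn x).symm⟩

end InverseSystem

open InverseSystem in
/-- if `0 → (A n) → (B n) → (C n) → 0` is a short exact sequence of
inverse systems of abelian groups indexed by `ℕ` and both `(A n)` and `(C n)`
have the Mittag-Leffler property, then so does `(B n)`. -/
theorem mittagLeffler_of_shortExact (A B C : ℕ → Type*)
    [∀ n, AddCommGroup (A n)] [∀ n, AddCommGroup (B n)] [∀ n, AddCommGroup (C n)]
    (fA : ∀ n, A (n + 1) →+ A n) (fB : ∀ n, B (n + 1) →+ B n) (fC : ∀ n, C (n + 1) →+ C n)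
    (ι : ∀ n, A n →+ B n) (π : ∀ n, B n →+ C n)
    (hinj : ∀ n, Function.Injective (ι n))
    (hsurj : ∀ n, Function.Surjective (π n))
    (hexact : ∀ n, (ι n).range = (π n).ker)
    (hcommι : ∀ n (a : A (n + 1)), ι n (fA n a) = fB n (ι (n + 1) a))
    (hcommπ : ∀ n (b : B (n + 1)), π n (fB n b) = fC n (π (n + 1) b))
    (hMLA : InverseSystem.IsMittagLeffler (fun n => (fA n : A (n + 1) → A n)))
    (hMLC : InverseSystem.IsMittagLeffler (fun n => (fC n : C (n + 1) → C n))) :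
    InverseSystem.IsMittagLeffler (fun n => (fB n : B (n + 1) → B n)) := by
  intro m
  obtain ⟨K, hmK, hK⟩ := hMLA m
  obtain ⟨N, hKN, hN⟩ := hMLC K
  refine ⟨N, hmK.trans hKN, fun n hNn =>
    (range_trans_subset _ (hmK.trans hKN) hNn).antisymm ?_⟩
  rintro _ ⟨b, rfl⟩
  -- Match `b` modulo `A` at level `K` by an element of `B n`, then correct the error by `A n`.
  obtain ⟨c, hc⟩ := (hN n hNn).ge ⟨π N b, rfl⟩
  obtain ⟨b', rfl⟩ := hsurj n c
  rw [← map_trans _ _ (fun n => π n) hcommπ, ← map_trans _ _ (fun n => π n) hcommπ] at hc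
  obtain ⟨a, ha⟩ : trans (fun n => fB n) hKN b - trans (fun n => fB n) (hKN.trans hNn) b' ∈
      (ι K).range := by
    rw [hexact, AddMonoidHom.mem_ker, map_sub, hc, sub_self]
  obtain ⟨a', ha'⟩ := (hK n (hKN.trans hNn)).ge ⟨a, rfl⟩
  refine ⟨b' + ι n a', ?_⟩
  rw [trans_add, ← map_trans _ _ (fun n => ι n) hcommι, ha',
    map_trans _ _ (fun n => ι n) hcommι, ha, trans_trans _ hmK (hKN.trans hNn), ← trans_add,
    add_sub_cancel, ← trans_trans]
end

section
/- Let (N_n) and (P_n) be inverse systems of abelian groups indexed by ℕ and let (π_n : N_n → P_n) be a morphism of inverse systems such that every π_n is surjective with finite kernel, and assume that all connecting homomorphisms N_{n+1} → N_n are injective. Then the induced homomorphism lim N_n → lim P_n is surjective with finite kernel, and the induced homomorphism lim¹ N_n → lim¹ P_n is an isomorphism. -/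
/-- The shift map `Δ : ∏ₙ Aₙ → ∏ₙ Aₙ`, `Δ((aₙ)ₙ) = (aₙ − fₙ(aₙ₊₁))ₙ`, of an
inverse system of abelian groups; `lim Aₙ = ker Δ` and `lim¹ Aₙ = coker Δ`. -/
def InverseSystem.shiftHom {A : ℕ → Type*} [∀ n, AddCommGroup (A n)]
    (f : ∀ n, A (n + 1) →+ A n) : (∀ n, A n) →+ (∀ n, A n) :=
  AddMonoidHom.mk' (fun a n => a n - f n (a (n + 1))) (by
    intro a b
    funext n
    simp only [Pi.add_apply, map_add]
    abel)

namespace InverseSystem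

/-- The shift map is surjective when all connecting homomorphisms from some index on are
surjective. -/
theorem shiftHom_surjective_of_eventually_surjective {A : ℕ → Type*}
    [∀ n, AddCommGroup (A n)] (f : ∀ n, A (n + 1) →+ A n) (m : ℕ)
    (hf : ∀ n, m ≤ n → Function.Surjective (f n)) :
    Function.Surjective (shiftHom f) := by
  induction m generalizing A with
  | zero =>
    intro k
    choose g hg using fun n => hf n n.zero_le
    refine ⟨fun n => Nat.rec 0 (fun n a => g n (a - k n)) n, ?_⟩
    funext n
    simp [shiftHom, hg]
  | succ m ih =>
    intro k
    obtain ⟨a, ha⟩ := ih (fun n => f (n + 1)) (fun n hn => hf (n + 1) (by omega))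
      (fun n => k (n + 1))
    refine ⟨fun n => Nat.casesOn n (k 0 + f 0 (a 0)) a, ?_⟩
    funext n
    cases n with
    | zero => simp [shiftHom]
    | succ n => exact congrFun ha n

/-- The shift map of an inverse system of finite groups with injective connecting
homomorphisms is surjective, since the connecting homomorphisms are eventually bijective. -/
theorem shiftHom_surjective_of_finite_of_injective {A : ℕ → Type*}
    [∀ n, AddCommGroup (A n)] [∀ n, Finite (A n)] (f : ∀ n, A (n + 1) →+ A n)
    (hf : ∀ n, Function.Injective (f n)) : Function.Surjective (shiftHom f) := by
  have hanti : Antitone fun n => Nat.card (A n) :=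
    antitone_nat_of_succ_le fun n => Nat.card_le_card_of_injective (f n) (hf n)
  let m := Function.argmin fun n => Nat.card (A n)
  refine shiftHom_surjective_of_eventually_surjective f m fun n hn => ?_
  refine ((hf n).bijective_of_nat_card_le ?_).surjective
  exact (hanti hn).trans (Function.argmin_le (fun n => Nat.card (A n)) (n + 1))

/-- Along a surjective morphism of inverse systems whose kernels are finite with injective
connecting homomorphisms, preimages under the shift map lift. -/
theorem exists_lift_shiftHom_eq {N P : ℕ → Type*}
    [∀ n, AddCommGroup (N n)] [∀ n, AddCommGroup (P n)]
    {fN : ∀ n, N (n + 1) →+ N n} {fP : ∀ n, P (n + 1) →+ P n} {π : ∀ n, N n →+ P n}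
    (hcomm : ∀ n (x : N (n + 1)), π n (fN n x) = fP n (π (n + 1) x))
    (hsurj : ∀ n, Function.Surjective (π n))
    (hfin : ∀ n, Finite (π n).ker)
    (hNinj : ∀ n, Function.Injective (fN n))
    {x : ∀ n, N n} {z : ∀ n, P n} (hxz : shiftHom fP z = fun n => π n (x n)) :
    ∃ w : ∀ n, N n, shiftHom fN w = x ∧ (fun n => π n (w n)) = z := by
  choose w hw using fun n => hsurj n (z n)
  let fK : ∀ n, (π (n + 1)).ker →+ (π n).ker := fun n =>
    ((fN n).comp (π (n + 1)).ker.subtype).codRestrict (π n).ker fun a => by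
      simp [AddMonoidHom.mem_ker, hcomm, (AddMonoidHom.mem_ker.mp a.2)]
  have hfK : ∀ n, Function.Injective (fK n) := fun n a b hab =>
    Subtype.ext (hNinj n (congrArg Subtype.val hab))
  have hmem : ∀ n, x n - shiftHom fN w n ∈ (π n).ker := fun n => by
    have h := congrFun hxz n
    simp only [shiftHom, AddMonoidHom.mk'_apply] at h ⊢
    simp [AddMonoidHom.mem_ker, hcomm, hw, ← h]
  obtain ⟨a, ha⟩ := shiftHom_surjective_of_finite_of_injective
    (A := fun n => (π n).ker) fK hfK fun n => ⟨_, hmem n⟩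
  refine ⟨w + fun n => (a n : N n), ?_, ?_⟩
  · have ha' : shiftHom fN (fun n => (a n : N n)) = x - shiftHom fN w :=
      funext fun n => congrArg Subtype.val (congrFun ha n)
    rw [map_add, ha', add_sub_cancel]
  · funext n
    simp [hw, AddMonoidHom.mem_ker.mp (a n).2]

/-- An element of the inverse limit is determined by its component at `0` when the connecting
homomorphisms are injective. -/
theorem eq_of_mem_ker_shiftHom {A : ℕ → Type*} [∀ n, AddCommGroup (A n)]
    {f : ∀ n, A (n + 1) →+ A n} (hf : ∀ n, Function.Injective (f n)) {x y : ∀ n, A n}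
    (hx : x ∈ (shiftHom f).ker) (hy : y ∈ (shiftHom f).ker) (h : x 0 = y 0) : x = y := by
  funext n
  induction n with
  | zero => exact h
  | succ n ih =>
    have hxn : x n = f n (x (n + 1)) := sub_eq_zero.mp (congrFun hx n)
    have hyn : y n = f n (y (n + 1)) := sub_eq_zero.mp (congrFun hy n)
    exact hf n (by rw [← hxn, ← hyn, ih])

end InverseSystem

/-- let `(π n : N n → P n)` be a morphism of inverse systems of
abelian groups indexed by `ℕ` with every `π n` surjective with finite kernel,
and with all connecting homomorphisms of `(N n)` injective.  Then the induced
homomorphism `lim N → lim P` is surjective with finite kernel, and the induced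
homomorphism `lim¹ N → lim¹ P` is an isomorphism (stated as: the composite
`∏ N → ∏ P → lim¹ P` is surjective with kernel exactly the image of the shift
map of `(N n)`, i.e. the induced map on cokernels of the shift maps is
bijective). -/
theorem lim_and_lim1_of_finite_kernels (N P : ℕ → Type*)
    [∀ n, AddCommGroup (N n)] [∀ n, AddCommGroup (P n)]
    (fN : ∀ n, N (n + 1) →+ N n) (fP : ∀ n, P (n + 1) →+ P n)
    (π : ∀ n, N n →+ P n)
    (hcomm : ∀ n (x : N (n + 1)), π n (fN n x) = fP n (π (n + 1) x))
    (hsurj : ∀ n, Function.Surjective (π n))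
    (hfin : ∀ n, Finite (π n).ker)
    (hNinj : ∀ n, Function.Injective (fN n)) :
    -- the induced map `lim N → lim P` is surjective …
    (∀ y ∈ (InverseSystem.shiftHom fP).ker, ∃ x ∈ (InverseSystem.shiftHom fN).ker,
        (fun n => π n (x n)) = y) ∧
    -- … with finite kernel,
    Finite {x : ∀ n, N n // x ∈ (InverseSystem.shiftHom fN).ker ∧
        (fun n => π n (x n)) = (0 : ∀ n, P n)} ∧
    -- and the induced map `lim¹ N → lim¹ P` is surjective …
    (∀ y : ∀ n, P n, ∃ x : ∀ n, N n,
        (fun n => π n (x n)) - y ∈ (InverseSystem.shiftHom fP).range) ∧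
    -- … and injective.
    (∀ x : ∀ n, N n, (fun n => π n (x n)) ∈ (InverseSystem.shiftHom fP).range →
        x ∈ (InverseSystem.shiftHom fN).range) := by
  refine ⟨fun y hy => ?_, ?_, fun y => ?_, fun x ⟨z, hz⟩ => ?_⟩
  · refine InverseSystem.exists_lift_shiftHom_eq (x := 0) hcomm hsurj hfin hNinj ?_
    simpa [← Pi.zero_def] using hy
  · refine Finite.of_injective (β := (π 0).ker)
      (fun x => ⟨x.1 0, congrFun x.2.2 0⟩) fun x y hxy => Subtype.ext ?_
    exact InverseSystem.eq_of_mem_ker_shiftHom hNinj x.2.1 y.2.1 (congrArg Subtype.val hxy)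
  · choose x hx using fun n => hsurj n (y n)
    exact ⟨x, by simp [hx]⟩
  · obtain ⟨w, hw, -⟩ := InverseSystem.exists_lift_shiftHom_eq hcomm hsurj hfin hNinj hz
    exact ⟨w, hw⟩
end

section
/- Let p be a prime number and let (A_n, f_n) be an inverse system of abelian groups indexed by ℕ such that for every n both the kernel and the cokernel of the connecting homomorphism f_n : A_{n+1} → A_n are killed by p. Then for every positive integer ℓ not divisible by p, the first derived limit lim¹ A_n is ℓ-divisible: every element of lim¹ A_n is ℓ times an element of lim¹ A_n. -/
/-- If the cokernel of `g` is killed by `p` and `ℓ` is coprime to `p`, then `g` is surjective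
modulo `ℓ`. -/
theorem AddMonoidHom.exists_eq_add_nsmul_of_coprime {B C : Type*} [AddCommGroup B]
    [AddCommGroup C] (g : B →+ C) {p ℓ : ℕ} (h : p.Coprime ℓ)
    (hcoker : ∀ y : C, p • y ∈ g.range) (z : C) : ∃ w t, z = g w + ℓ • t := by
  obtain ⟨u, v, huv⟩ := Nat.isCoprime_iff_coprime.mpr h
  obtain ⟨w, hw⟩ := hcoker z
  refine ⟨u • w, v • z, ?_⟩
  rw [map_zsmul, hw, ← natCast_zsmul, ← natCast_zsmul, smul_smul, smul_smul, ← add_smul,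
    mul_comm (ℓ : ℤ), huv, one_smul]

/-- let `p` be a prime and `(A n, f n)` an inverse system of
abelian groups indexed by `ℕ` such that for every `n` the kernel and cokernel
of `f n : A (n+1) → A n` are killed by `p`.  Then for every positive integer
`ℓ` not divisible by `p`, the first derived limit `lim¹ Aₙ = coker Δ` is
`ℓ`-divisible. -/
theorem lim1_divisible_of_p_kernels_cokernels (p : ℕ) (hp : p.Prime)
    (A : ℕ → Type*) [∀ n, AddCommGroup (A n)] (f : ∀ n, A (n + 1) →+ A n)
    (hker : ∀ n, ∀ x ∈ (f n).ker, p • x = 0)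
    (hcoker : ∀ n, ∀ y : A n, p • y ∈ (f n).range)
    (ℓ : ℕ) (hℓ : 0 < ℓ) (hpℓ : ¬ p ∣ ℓ) :
    ∀ y : (∀ n, A n) ⧸ (InverseSystem.shiftHom f).range,
      ∃ x : (∀ n, A n) ⧸ (InverseSystem.shiftHom f).range, ℓ • x = y := by
  choose w t hwt using fun n =>
    (f n).exists_eq_add_nsmul_of_coprime ((hp.coprime_iff_not_dvd).mpr hpℓ) (hcoker n)
  intro y
  induction y using QuotientAddGroup.induction_on with | _ y
  let a : ∀ n, A n := fun n => Nat.rec 0 (fun n an => w n (an - y n)) n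
  refine ⟨QuotientAddGroup.mk fun n => -t n (a n - y n), ?_⟩
  rw [← QuotientAddGroup.mk_nsmul, QuotientAddGroup.eq]
  refine ⟨a, funext fun n => ?_⟩
  have h : a n - y n = f n (a (n + 1)) + ℓ • t n (a n - y n) := hwt n _
  change a n - f n (a (n + 1)) = -(ℓ • -t n (a n - y n)) + y n
  rw [smul_neg, neg_neg, sub_eq_iff_eq_add, add_right_comm, add_comm (ℓ • _), ← h,
    sub_add_cancel]
end

section
/- Let p be a prime number and let (A_n, f_n) be an inverse system of abelian groups indexed by ℕ such that for every n both the kernel and the cokernel of the connecting homomorphism f_n : A_{n+1} → A_n are killed by p. Let ℓ be a positive integer not divisible by p. Then the ℓ-torsion subgroup (lim¹ A_n)[ℓ] is naturally isomorphic to the cokernel of the homomorphism (lim A_n)/ℓ(lim A_n) → A_0/ℓA_0 induced by the projection lim A_n → A_0. -/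
/-- Multiplication by `ℓ` as an additive group endomorphism. -/
def nsmulHom (G : Type*) [AddCommGroup G] (ℓ : ℕ) : G →+ G :=
  AddMonoidHom.mk' (fun g => ℓ • g) (fun a b => smul_add ℓ a b)

/-- The first derived limit `lim¹ Aₙ = coker Δ` of an inverse system of abelian
groups indexed by `ℕ`. -/
def InverseSystem.lim1 {A : ℕ → Type*} [∀ n, AddCommGroup (A n)]
    (f : ∀ n, A (n + 1) →+ A n) : Type _ :=
  (∀ n, A n) ⧸ (InverseSystem.shiftHom f).range

noncomputable instance {A : ℕ → Type*} [∀ n, AddCommGroup (A n)]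
    (f : ∀ n, A (n + 1) →+ A n) : AddCommGroup (InverseSystem.lim1 f) :=
  QuotientAddGroup.Quotient.addCommGroup _

/-- The homomorphism `lim Aₙ → A 0 / ℓ·A 0` induced by the projection
`lim Aₙ → A 0` (it has the same range as the induced homomorphism
`(lim Aₙ)/ℓ(lim Aₙ) → A 0/ℓ·A 0`, so the two maps have the same cokernel). -/
def InverseSystem.limToZeroModSmul {A : ℕ → Type*} [∀ n, AddCommGroup (A n)]
    (f : ∀ n, A (n + 1) →+ A n) (ℓ : ℕ) :
    (InverseSystem.shiftHom f).ker →+ (A 0 ⧸ (nsmulHom (A 0) ℓ).range) :=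
  (QuotientAddGroup.mk' _).comp
    ((Pi.evalAddMonoidHom A 0).comp (InverseSystem.shiftHom f).ker.subtype)

@[simp]
theorem nsmulHom_apply {G : Type*} [AddCommGroup G] (ℓ : ℕ) (g : G) :
    nsmulHom G ℓ g = ℓ • g := rfl

namespace InverseSystem

/-- If `p • ·` maps `B` into the range of `g : C → B` and `p` is coprime to `ℓ`, then `g` is
surjective modulo `ℓ`. -/
theorem exists_sub_map_eq_nsmul {B C : Type*} [AddCommGroup B] [AddCommGroup C] {g : C →+ B}
    {p ℓ : ℕ} (hcop : p.Coprime ℓ) (hcoker : ∀ y, p • y ∈ g.range) (y : B) :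
    ∃ x z, y - g x = ℓ • z := by
  obtain ⟨u, v, huv⟩ := Nat.isCoprime_iff_coprime.mpr hcop
  obtain ⟨x, hx⟩ := hcoker y
  refine ⟨u • x, v • y, ?_⟩
  rw [map_zsmul, hx, sub_eq_iff_eq_add]
  simp only [← natCast_zsmul, smul_smul, ← add_smul]
  rw [mul_comm (ℓ : ℤ), add_comm, huv, one_smul]

/-- If `g : C → B` has kernel and cokernel killed by `p` and `p` is coprime to `ℓ`, then `g` is
injective modulo `ℓ`. -/
theorem exists_eq_nsmul_of_map_eq_nsmul {B C : Type*} [AddCommGroup B] [AddCommGroup C]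
    {g : C →+ B} {p ℓ : ℕ} (hcop : p.Coprime ℓ) (hker : ∀ x ∈ g.ker, p • x = 0)
    (hcoker : ∀ y, p • y ∈ g.range) {a : C} {c : B} (h : g a = ℓ • c) :
    ∃ d, a = ℓ • d := by
  obtain ⟨u, v, huv⟩ := Nat.isCoprime_iff_coprime.mpr hcop
  obtain ⟨d, hd⟩ := hcoker c
  have hmem : p • (p • a - ℓ • d) = 0 := hker _ (by
    rw [AddMonoidHom.mem_ker, map_sub, map_nsmul, map_nsmul, h, hd, smul_comm, sub_self])
  have ha : (u * p + v * ℓ) • a = a := by rw [huv, one_smul]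
  refine ⟨(u * u * p) • d + (u * p * v + v) • a, ?_⟩
  have hu : (u * u) • (p • (p • a - ℓ • d)) = 0 := by rw [hmem, smul_zero]
  have hv : (u * p) • ((u * p + v * ℓ) • a) = (u * p) • a := by rw [ha]
  rw [← sub_eq_zero, ← hu]
  nth_rewrite 1 [← ha]
  rw [add_smul (u * (p : ℤ)), ← hv]
  simp only [← natCast_zsmul]
  module

/-- If `g : C → B` has kernel and cokernel killed by `p` and `p` is coprime to `ℓ`, then `g` is
surjective on `ℓ`-torsion. -/
theorem exists_map_eq_of_nsmul_eq_zero {B C : Type*} [AddCommGroup B] [AddCommGroup C]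
    {g : C →+ B} {p ℓ : ℕ} (hcop : p.Coprime ℓ) (hker : ∀ x ∈ g.ker, p • x = 0)
    (hcoker : ∀ y, p • y ∈ g.range) {y : B} (hy : ℓ • y = 0) :
    ∃ x, g x = y ∧ ℓ • x = 0 := by
  obtain ⟨u, v, huv⟩ := Nat.isCoprime_iff_coprime.mpr hcop
  obtain ⟨x, hx⟩ := hcoker y
  have hpu : (u * p) • y = y := by
    have h : (u * p + v * ℓ) • y = y := by rw [huv, one_smul]
    rwa [add_smul, mul_smul v, natCast_zsmul, hy, smul_zero, add_zero] at h
  have hmem : p • (ℓ • x) = 0 := hker _ (by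
    rw [AddMonoidHom.mem_ker, map_nsmul, hx, smul_comm, hy, smul_zero])
  refine ⟨(u * p) • u • x, ?_, ?_⟩
  · rw [map_zsmul, map_zsmul, hx, ← natCast_zsmul, smul_smul u, hpu, hpu]
  · have h : (u * u) • (p • (ℓ • x)) = 0 := by rw [hmem, smul_zero]
    rw [← h]
    simp only [← natCast_zsmul]
    module

variable {A : ℕ → Type*} [∀ n, AddCommGroup (A n)]

@[simp]
theorem shiftHom_apply (f : ∀ n, A (n + 1) →+ A n) (a : ∀ n, A n) (n : ℕ) :
    shiftHom f a n = a n - f n (a (n + 1)) := rfl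

/-- The pairs `(a, b)` with `Δ a = ℓ • b`. -/
def shiftEqNsmul (f : ∀ n, A (n + 1) →+ A n) (ℓ : ℕ) :
    AddSubgroup ((∀ n, A n) × (∀ n, A n)) :=
  ((shiftHom f).comp (AddMonoidHom.fst _ _)).eqLocus
    ((nsmulHom _ ℓ).comp (AddMonoidHom.snd _ _))

theorem mem_shiftEqNsmul {f : ∀ n, A (n + 1) →+ A n} {ℓ : ℕ}
    {x : (∀ n, A n) × (∀ n, A n)} :
    x ∈ shiftEqNsmul f ℓ ↔ shiftHom f x.1 = ℓ • x.2 := Iff.rfl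

/-- The projection of `∏ Aₙ` onto `lim¹ Aₙ`. -/
noncomputable def toLim1 (f : ∀ n, A (n + 1) →+ A n) : (∀ n, A n) →+ lim1 f :=
  QuotientAddGroup.mk' (shiftHom f).range

theorem toLim1_surjective (f : ∀ n, A (n + 1) →+ A n) : Function.Surjective (toLim1 f) :=
  QuotientAddGroup.mk'_surjective _

theorem toLim1_eq_zero_iff {f : ∀ n, A (n + 1) →+ A n} {b : ∀ n, A n} :
    toLim1 f b = 0 ↔ ∃ c, shiftHom f c = b :=
  QuotientAddGroup.eq_zero_iff b

/-- The map `(a, b) ↦ [b]` from `{(a, b) | Δ a = ℓ • b}` to `(lim¹ Aₙ)[ℓ]`. -/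
noncomputable def toTorsion (f : ∀ n, A (n + 1) →+ A n) (ℓ : ℕ) :
    shiftEqNsmul f ℓ →+ (nsmulHom (lim1 f) ℓ).ker :=
  (((toLim1 f).comp (AddMonoidHom.snd _ _)).comp (shiftEqNsmul f ℓ).subtype).codRestrict _
    fun x => by
      change ℓ • toLim1 f x.1.2 = 0
      rw [← map_nsmul, toLim1_eq_zero_iff]
      exact ⟨_, mem_shiftEqNsmul.mp x.2⟩

theorem toTorsion_eq_zero_iff {f : ∀ n, A (n + 1) →+ A n} {ℓ : ℕ} {x : shiftEqNsmul f ℓ} :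
    toTorsion f ℓ x = 0 ↔ ∃ c, shiftHom f c = x.1.2 :=
  Subtype.ext_iff.trans toLim1_eq_zero_iff

theorem toTorsion_surjective (f : ∀ n, A (n + 1) →+ A n) (ℓ : ℕ) :
    Function.Surjective (toTorsion f ℓ) := by
  rintro ⟨y, hy⟩
  obtain ⟨b, rfl⟩ := toLim1_surjective f y
  rw [AddMonoidHom.mem_ker, nsmulHom_apply, ← map_nsmul, toLim1_eq_zero_iff] at hy
  obtain ⟨a, ha⟩ := hy
  exact ⟨⟨(a, b), ha⟩, rfl⟩

/-- The map `(a, b) ↦ [a₀]` from `{(a, b) | Δ a = ℓ • b}` to the cokernel of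
`lim Aₙ → A₀ / ℓ • A₀`. -/
def toCoker (f : ∀ n, A (n + 1) →+ A n) (ℓ : ℕ) :
    shiftEqNsmul f ℓ →+
      (A 0 ⧸ (nsmulHom (A 0) ℓ).range) ⧸ (limToZeroModSmul f ℓ).range :=
  (QuotientAddGroup.mk' _).comp ((QuotientAddGroup.mk' _).comp
    ((Pi.evalAddMonoidHom A 0).comp
      ((AddMonoidHom.fst _ _).comp (shiftEqNsmul f ℓ).subtype)))

theorem toCoker_eq_zero_iff {f : ∀ n, A (n + 1) →+ A n} {ℓ : ℕ} {x : shiftEqNsmul f ℓ} :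
    toCoker f ℓ x = 0 ↔ ∃ z, shiftHom f z = 0 ∧ ∃ d, x.1.1 0 = z 0 + ℓ • d := by
  have h : toCoker f ℓ x = 0 ↔ ∃ z : (shiftHom f).ker,
      (QuotientAddGroup.mk (z.1 0) : A 0 ⧸ (nsmulHom (A 0) ℓ).range) =
        QuotientAddGroup.mk (x.1.1 0) := QuotientAddGroup.eq_zero_iff _
  simp only [h, QuotientAddGroup.eq, Subtype.exists, AddMonoidHom.mem_range, nsmulHom_apply,
    AddMonoidHom.mem_ker, exists_prop, eq_neg_add_iff_add_eq, eq_comm]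

variable {f : ∀ n, A (n + 1) →+ A n} {p ℓ : ℕ}

theorem toCoker_surjective (hcop : p.Coprime ℓ) (hcoker : ∀ n, ∀ y : A n, p • y ∈ (f n).range) :
    Function.Surjective (toCoker f ℓ) := by
  intro y
  obtain ⟨y, rfl⟩ := QuotientAddGroup.mk_surjective y
  obtain ⟨a₀, rfl⟩ := QuotientAddGroup.mk_surjective y
  choose s t hst using fun n => exists_sub_map_eq_nsmul hcop (hcoker n)
  let a : ∀ n, A n := fun n => Nat.rec a₀ (fun n y => s n y) n
  exact ⟨⟨(a, fun n => t n (a n)), funext fun n => hst n (a n)⟩, rfl⟩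

/-- An element `a` with `Δ a` divisible by `ℓ` and `a₀` divisible by `ℓ` is divisible by `ℓ`. -/
theorem exists_eq_nsmul_of_shiftHom (hcop : p.Coprime ℓ)
    (hker : ∀ n, ∀ x ∈ (f n).ker, p • x = 0) (hcoker : ∀ n, ∀ y : A n, p • y ∈ (f n).range)
    {a b : ∀ n, A n} (hab : shiftHom f a = ℓ • b) (h₀ : ∃ d, a 0 = ℓ • d) :
    ∃ c, a = ℓ • c := by
  have h (n : ℕ) : ∃ d, a n = ℓ • d := by
    induction n with
    | zero => exact h₀
    | succ n ih =>
      obtain ⟨d, hd⟩ := ih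
      have hn : a n - f n (a (n + 1)) = ℓ • b n := congrFun hab n
      refine exists_eq_nsmul_of_map_eq_nsmul hcop (hker n) (hcoker n) (c := d - b n) ?_
      rw [smul_sub, ← hd, ← hn, sub_sub_cancel]
  choose c hc using h
  exact ⟨c, funext hc⟩

/-- The `ℓ`-torsion of `∏ Aₙ` lies in the range of the shift map. -/
theorem exists_shiftHom_eq_of_nsmul_eq_zero (hcop : p.Coprime ℓ)
    (hker : ∀ n, ∀ x ∈ (f n).ker, p • x = 0) (hcoker : ∀ n, ∀ y : A n, p • y ∈ (f n).range)
    {t : ∀ n, A n} (ht : ℓ • t = 0) :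
    ∃ c, shiftHom f c = t := by
  have hstep (n : ℕ) (y : {y : A n // ℓ • y = 0}) :
      ∃ x : {x : A (n + 1) // ℓ • x = 0}, f n x = y - t n := by
    obtain ⟨x, hx, hx'⟩ := exists_map_eq_of_nsmul_eq_zero hcop (hker n) (hcoker n)
      (y := y - t n) (by rw [smul_sub, y.2, zero_sub, neg_eq_zero]; exact congrFun ht n)
    exact ⟨⟨x, hx'⟩, hx⟩
  choose s hs using hstep
  let c : ∀ n, {y : A n // ℓ • y = 0} :=
    fun n => Nat.rec ⟨0, smul_zero ℓ⟩ (fun n y => s n y) n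
  refine ⟨fun n => (c n).1, funext fun n => ?_⟩
  have hn : f n (c (n + 1)).1 = (c n).1 - t n := hs n (c n)
  rw [shiftHom_apply, hn, sub_sub_cancel]

theorem ker_toTorsion_eq_ker_toCoker (hcop : p.Coprime ℓ)
    (hker : ∀ n, ∀ x ∈ (f n).ker, p • x = 0)
    (hcoker : ∀ n, ∀ y : A n, p • y ∈ (f n).range) :
    (toTorsion f ℓ).ker = (toCoker f ℓ).ker := by
  ext ⟨⟨a, b⟩, hab⟩
  rw [mem_shiftEqNsmul] at hab
  rw [AddMonoidHom.mem_ker, AddMonoidHom.mem_ker, toTorsion_eq_zero_iff, toCoker_eq_zero_iff]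
  constructor
  · rintro ⟨c, rfl⟩
    refine ⟨a - ℓ • c, ?_, c 0, ?_⟩
    · rw [map_sub, map_nsmul, hab, sub_self]
    · simp
  · rintro ⟨z, hz, d, hd⟩
    obtain ⟨c, hc⟩ := exists_eq_nsmul_of_shiftHom hcop hker hcoker (a := a - z) (b := b)
      (by rw [map_sub, hz, sub_zero, hab]) ⟨d, by rw [Pi.sub_apply, sub_eq_iff_eq_add']; exact hd⟩
    obtain ⟨e, he⟩ := exists_shiftHom_eq_of_nsmul_eq_zero hcop hker hcoker
      (t := b - shiftHom f c)
      (by rw [smul_sub, ← map_nsmul, ← hc, map_sub, hz, sub_zero, hab, sub_self])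
    exact ⟨c + e, by rw [map_add, he, add_sub_cancel]⟩

end InverseSystem

/-- let `p` be a prime and `(A n, f n)` an inverse system of
abelian groups indexed by `ℕ` whose connecting maps have kernel and cokernel
killed by `p`, and let `ℓ` be a positive integer not divisible by `p`.  Then
the `ℓ`-torsion subgroup `(lim¹ Aₙ)[ℓ]` is isomorphic to the cokernel of the
homomorphism `(lim Aₙ)/ℓ(lim Aₙ) → A 0/ℓ·A 0` induced by the projection
`lim Aₙ → A 0`. -/
theorem lim1_torsion_iso_coker (p : ℕ) (hp : p.Prime)
    (A : ℕ → Type*) [∀ n, AddCommGroup (A n)] (f : ∀ n, A (n + 1) →+ A n)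
    (hker : ∀ n, ∀ x ∈ (f n).ker, p • x = 0)
    (hcoker : ∀ n, ∀ y : A n, p • y ∈ (f n).range)
    (ℓ : ℕ) (hℓ : 0 < ℓ) (hpℓ : ¬ p ∣ ℓ) :
    Nonempty
      ((nsmulHom (InverseSystem.lim1 f) ℓ).ker ≃+
        ((A 0 ⧸ (nsmulHom (A 0) ℓ).range) ⧸ (InverseSystem.limToZeroModSmul f ℓ).range)) := by
  have hcop : p.Coprime ℓ := (Nat.Prime.coprime_iff_not_dvd hp).mpr hpℓ
  exact ⟨(QuotientAddGroup.quotientKerEquivOfSurjective _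
      (InverseSystem.toTorsion_surjective f ℓ)).symm.trans
    ((QuotientAddGroup.quotientAddEquivOfEq
      (InverseSystem.ker_toTorsion_eq_ker_toCoker hcop hker hcoker)).trans
    (QuotientAddGroup.quotientKerEquivOfSurjective _
      (InverseSystem.toCoker_surjective hcop hcoker)))⟩
end

section
/- Let k be a field and let (A, 𝔪) be a Noetherian local k-algebra which is 𝔪-adically complete and whose structure map induces an isomorphism k → A/𝔪. Let k'/k be a field extension, and let A' denote the completion of the ring A ⊗_k k' with respect to the ideal I = 𝔪·(A ⊗_k k') generated by the image of 𝔪. Then A' is a Noetherian complete local ring whose maximal ideal is the ideal generated by the image of 𝔪, and the induced map k' → A'/𝔪A' is an isomorphism, so the residue field of A' is k'. -/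
open scoped TensorProduct

/-- A ring `S` that is adically complete with respect to a finitely generated ideal `M` is
Noetherian as soon as `S ⧸ M` is a quotient of a Noetherian ring mapping to `S`. -/
theorem isNoetherianRing_of_isAdicComplete_of_surjective {K S : Type*} [CommRing K]
    [IsNoetherianRing K] [CommRing S] [Algebra K S] (M : Ideal S) [IsAdicComplete M S]
    (hfg : M.FG) (hsurj : Function.Surjective ((Ideal.Quotient.mk M).comp (algebraMap K S))) :
    IsNoetherianRing S := by
  obtain ⟨n, g, hg⟩ := Submodule.fg_iff_exists_fin_generating_family.mp hfg
  let J := MvPolynomial.idealOfVars (Fin n) K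
  let φ : MvPolynomial (Fin n) K →+* S := (MvPolynomial.aeval g).toRingHom
  have hJ : J.map φ = M := by
    rw [← hg]
    simp only [J, φ, MvPolynomial.idealOfVars, Ideal.map_span, ← Set.range_comp]
    congr 2
    ext i
    simp
  have hpow (m : ℕ) : J ^ m ≤ (M ^ m).comap φ := by
    rw [← Ideal.map_le_iff_le_comap, Ideal.map_pow, hJ]
  let f (m : ℕ) : AdicCompletion J (MvPolynomial (Fin n) K) →+* S ⧸ M ^ m :=
    (Ideal.quotientMap (M ^ m) φ (hpow m)).comp (AdicCompletion.evalₐ J m).toRingHom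
  have hf {a b : ℕ} (hab : a ≤ b) : (Ideal.Quotient.factorPow M hab).comp (f b) = f a := by
    ext x
    obtain ⟨x, rfl⟩ := AdicCompletion.mk_surjective J _ x
    have := AdicCompletion.Ideal.mk_eq_mk J hab x
    simp only [f, RingHom.comp_apply, AlgHom.toRingHom_eq_coe, RingHom.coe_coe,
      AdicCompletion.evalₐ_mk, Ideal.quotientMap_mk, ← this]
    rfl
  let F := IsAdicComplete.liftRingHom M f hf
  have hF : F.comp (algebraMap _ _) = φ := by
    refine RingHom.ext fun x ↦ ?_
    refine (IsHausdorff.eq_iff_smodEq (I := M)).mpr fun m ↦ ?_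
    rw [smul_eq_mul, Ideal.mul_top, SModEq, Ideal.Quotient.mk_eq_mk, Ideal.Quotient.mk_eq_mk]
    refine (IsAdicComplete.mk_liftRingHom M f hf m _).trans ?_
    simp [f, AdicCompletion.algebraMap_apply]
  have hmap : (J.map (algebraMap _ (AdicCompletion J _))).map F = M := by
    rw [Ideal.map_map, hF, hJ]
  have := AdicCompletion.isAdicComplete_self J (MvPolynomial.idealOfVars_fg (Fin n) K)
  have : IsHausdorff ((J.map (algebraMap _ (AdicCompletion J _))).map F) S := by
    rw [hmap]; infer_instance
  have hFsurj : Function.Surjective F := by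
    refine surjective_of_mk_map_comp_surjective (I := J.map (algebraMap _ (AdicCompletion J _)))
      F ?_
    rw [hmap]
    intro y
    obtain ⟨c, rfl⟩ := hsurj y
    refine ⟨algebraMap (MvPolynomial (Fin n) K) _ (MvPolynomial.C c), ?_⟩
    have := RingHom.congr_fun hF (MvPolynomial.C c)
    simp only [RingHom.comp_apply] at this ⊢
    rw [this]
    simp [φ]
  have := isNoetherianRing_of_ringEquiv _
    (MvPowerSeries.toAdicCompletionAlgEquiv (Fin n) K).toRingEquiv
  exact isNoetherianRing_of_surjective _ _ F hFsurj

/-- If `k` is the residue field of the `k`-algebra `A` at `m`, then `k'` is the quotient of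
`A ⊗[k] k'` by the ideal generated by the image of `m`. -/
theorem bijective_mk_map_comp_includeRight {k A k' : Type*} [Field k] [CommRing A] [Algebra k A]
    [Field k'] [Algebra k k'] (m : Ideal A)
    (hres : Function.Bijective ((Ideal.Quotient.mk m).comp (algebraMap k A))) :
    Function.Bijective ((Ideal.Quotient.mk (m.map (algebraMap A (A ⊗[k] k')))).comp
      (Algebra.TensorProduct.includeRight : k' →ₐ[k] A ⊗[k] k').toRingHom) := by
  constructor
  · let e : k ≃ₐ[k] A ⧸ m := AlgEquiv.ofBijective (Algebra.ofId k (A ⧸ m)) hres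
    let ρ : A →ₐ[k] k' := ((Algebra.ofId k k').comp e.symm.toAlgHom).comp (Ideal.Quotient.mkₐ k m)
    let ψ : A ⊗[k] k' →ₐ[k] k' :=
      Algebra.TensorProduct.lift ρ (AlgHom.id k k') fun _ _ ↦ Commute.all _ _
    have hle : m.map (algebraMap A (A ⊗[k] k')) ≤ RingHom.ker ψ := by
      rw [Ideal.map_le_iff_le_comap]
      intro a ha
      have : Ideal.Quotient.mk m a = 0 := Ideal.Quotient.eq_zero_iff_mem.mpr ha
      simp [ψ, ρ, RingHom.mem_ker, this]
    have : Nontrivial ((A ⊗[k] k') ⧸ m.map (algebraMap A (A ⊗[k] k'))) :=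
      Ideal.Quotient.nontrivial_iff.mpr (ne_top_of_le_ne_top (RingHom.ker_ne_top ψ) hle)
    exact RingHom.injective _
  · intro y
    obtain ⟨y, rfl⟩ := Ideal.Quotient.mk_surjective y
    induction y with
    | zero => exact ⟨0, by simp⟩
    | add x y hx hy =>
      obtain ⟨a, ha⟩ := hx
      obtain ⟨b, hb⟩ := hy
      exact ⟨a + b, by rw [map_add, ha, hb, map_add]⟩
    | tmul a c =>
      obtain ⟨r, hr⟩ := hres.2 (Ideal.Quotient.mk m a)
      refine ⟨r • c, ?_⟩
      have hmem : algebraMap k A r - a ∈ m := Ideal.Quotient.eq.mp hr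
      refine Ideal.Quotient.eq.mpr ?_
      have : (1 : A) ⊗ₜ[k] (r • c) - a ⊗ₜ[k] c =
          algebraMap A (A ⊗[k] k') (algebraMap k A r - a) * (1 ⊗ₜ[k] c) := by
        rw [TensorProduct.tmul_smul, TensorProduct.smul_tmul', ← TensorProduct.sub_tmul]
        simp [Algebra.algebraMap_eq_smul_one, TensorProduct.smul_tmul']
      exact this ▸ Ideal.mul_mem_right _ _ (Ideal.mem_map_of_mem _ hmem)

/-- Completing `R` along a finitely generated ideal `I` does not change the quotient by `I`. -/
theorem AdicCompletion.bijective_mk_map_comp {R K : Type*} [CommRing R] [NonAssocSemiring K]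
    (I : Ideal R) (hfg : I.FG) (f : K →+* R)
    (hf : Function.Bijective ((Ideal.Quotient.mk I).comp f)) :
    Function.Bijective ((Ideal.Quotient.mk (I.map (algebraMap R (AdicCompletion I R)))).comp
      ((algebraMap R (AdicCompletion I R)).comp f)) := by
  have hker := AdicCompletion.ker_evalOneₐ_eq_map I hfg
  let e : (AdicCompletion I R ⧸ I.map (algebraMap R (AdicCompletion I R))) ≃+* R ⧸ I :=
    (Ideal.quotEquivOfEq hker.symm).trans
      (RingHom.quotientKerEquivOfSurjective (AdicCompletion.evalOneₐ_surjective I))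
  refine (Function.Bijective.of_comp_iff' e.bijective _).mp ?_
  convert hf using 1
  rfl

/-- let `k` be a field and `(A, 𝔪)` a Noetherian local `k`-algebra
which is `𝔪`-adically complete and whose structure map induces an isomorphism
`k ≃ A/𝔪`.  Let `k'/k` be a field extension and let `A'` be the completion of
`A ⊗_k k'` with respect to the ideal `I = 𝔪·(A ⊗_k k')` generated by the image
of `𝔪`.  Then `A'` is a Noetherian complete local ring whose maximal ideal `M'`
is the ideal generated by the image of `𝔪`, and the induced map `k' → A'/M'`
is an isomorphism, so the residue field of `A'` is `k'`. -/
theorem completedTensorProduct_noetherian_complete_local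
    (k : Type*) [Field k] (A : Type*) [CommRing A] [Algebra k A]
    [IsNoetherianRing A] [IsLocalRing A]
    (hcomplete : IsAdicComplete (IsLocalRing.maximalIdeal A) A)
    (hres : Function.Bijective
      ((Ideal.Quotient.mk (IsLocalRing.maximalIdeal A)).comp (algebraMap k A)))
    (k' : Type*) [Field k'] [Algebra k k']
    -- `I = 𝔪·(A ⊗_k k')`, the ideal generated by the image of `𝔪`
    (I : Ideal (A ⊗[k] k'))
    (hI : I = Ideal.map (algebraMap A (A ⊗[k] k')) (IsLocalRing.maximalIdeal A))
    -- `M'` is the ideal of `A' = AdicCompletion I (A ⊗_k k')` generated by the image of `𝔪`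
    (M' : Ideal (AdicCompletion I (A ⊗[k] k')))
    (hM' : M' = Ideal.map
      ((algebraMap (A ⊗[k] k') (AdicCompletion I (A ⊗[k] k'))).comp
        (algebraMap A (A ⊗[k] k')))
      (IsLocalRing.maximalIdeal A)) :
    IsNoetherianRing (AdicCompletion I (A ⊗[k] k')) ∧
    IsLocalRing (AdicCompletion I (A ⊗[k] k')) ∧
    M'.IsMaximal ∧
    (∀ J : Ideal (AdicCompletion I (A ⊗[k] k')), J ≠ ⊤ → J ≤ M') ∧
    IsAdicComplete M' (AdicCompletion I (A ⊗[k] k')) ∧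
    Function.Bijective
      ((Ideal.Quotient.mk M').comp
        ((algebraMap (A ⊗[k] k') (AdicCompletion I (A ⊗[k] k'))).comp
          (Algebra.TensorProduct.includeRight : k' →ₐ[k] A ⊗[k] k').toRingHom)) := by
  have hfg : I.FG := hI ▸ Ideal.FG.map (IsNoetherian.noetherian _) _
  have hM'I : M' = I.map (algebraMap _ (AdicCompletion I (A ⊗[k] k'))) := by
    rw [hM', hI, Ideal.map_map]
  have hbij : Function.Bijective ((Ideal.Quotient.mk M').comp
      ((algebraMap (A ⊗[k] k') (AdicCompletion I (A ⊗[k] k'))).comp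
        (Algebra.TensorProduct.includeRight : k' →ₐ[k] A ⊗[k] k').toRingHom)) := by
    subst hM'I
    refine AdicCompletion.bijective_mk_map_comp I hfg _ ?_
    subst hI
    exact bijective_mk_map_comp_includeRight _ hres
  have hcompl : IsAdicComplete M' (AdicCompletion I (A ⊗[k] k')) :=
    hM'I ▸ AdicCompletion.isAdicComplete_self I hfg
  have hmax : M'.IsMaximal := Ideal.Quotient.maximal_of_isField _
    ((RingEquiv.ofBijective _ hbij).symm.toMulEquiv.isField (Field.toIsField k'))
  have hlocal := isLocalRing_of_isAdicComplete_maximal M'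
  refine ⟨?_, hlocal, hmax, fun J hJ ↦ ?_, hcompl, hbij⟩
  · algebraize [(algebraMap (A ⊗[k] k') (AdicCompletion I (A ⊗[k] k'))).comp
      (Algebra.TensorProduct.includeRight : k' →ₐ[k] A ⊗[k] k').toRingHom]
    exact isNoetherianRing_of_isAdicComplete_of_surjective M' (hM'I ▸ Ideal.FG.map hfg _) hbij.2
  · rw [IsLocalRing.eq_maximalIdeal hmax]
    exact IsLocalRing.le_maximalIdeal hJ
end
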